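/- Let n ≥ 1 and let T₂, T₁, T₀ be finite types. Let d₂ : (T₂ → ZMod n) →ₗ[ZMod n] (T₁ → ZMod n) and d₁ : (T₁ → ZMod n) →ₗ[ZMod n] (T₀ → ZMod n) be linear maps with d₁ ∘ d₂ = 0. Let C be the ℂ-subspace of functions f : (T₁ → ZMod n) → ℂ satisfying both: (i) f(x) = 0 whenever d₁(x) ≠ 0, and (ii) f(x + d₂(y)) = f(x) for all x and all y : T₂ → ZMod n. Then C is ℂ-linearly isomorphic to the space of all ℂ-valued functions on the homology module H := ker d₁ ⧸ B, where B is the submodule of ker d₁ consisting of elements lying in the range of d₂. In particular dim_ℂ C = |H|, so the code space of the ℤ_n toric code on a chain complex is isomorphic to ℂ[H_k(T, ℤ_n)]. -/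

import Mathlib

/-- The code space: complex-valued functions on `ℤ_n`-chains which vanish off the cycles of
`d₁` and are invariant under adding boundaries from `d₂`. -/
noncomputable def codeSpace {n : ℕ} {T₂ T₁ T₀ : Type}
    (d₂ : (T₂ → ZMod n) →ₗ[ZMod n] (T₁ → ZMod n))
    (d₁ : (T₁ → ZMod n) →ₗ[ZMod n] (T₀ → ZMod n)) :
    Submodule ℂ ((T₁ → ZMod n) → ℂ) where
  carrier := {f | (∀ x, d₁ x ≠ 0 → f x = 0) ∧ ∀ (x) (y : T₂ → ZMod n), f (x + d₂ y) = f x}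
  zero_mem' := ⟨fun _ _ => rfl, fun _ _ => rfl⟩
  add_mem' := by
    rintro f g ⟨hf1, hf2⟩ ⟨hg1, hg2⟩
    exact ⟨fun x hx => by simp [hf1 x hx, hg1 x hx],
      fun x y => by simp only [Pi.add_apply, hf2 x y, hg2 x y]⟩
  smul_mem' := by
    rintro c f ⟨hf1, hf2⟩
    exact ⟨fun x hx => by simp [hf1 x hx],
      fun x y => by simp only [Pi.smul_apply, hf2 x y]⟩

/-- The boundaries inside the cycles: elements of `ker d₁` whose underlying chain lies in the
range of `d₂`. -/
def boundariesIn {n : ℕ} {T₂ T₁ T₀ : Type}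
    (d₂ : (T₂ → ZMod n) →ₗ[ZMod n] (T₁ → ZMod n))
    (d₁ : (T₁ → ZMod n) →ₗ[ZMod n] (T₀ → ZMod n)) :
    Submodule (ZMod n) (LinearMap.ker d₁) :=
  (LinearMap.range d₂).comap (LinearMap.ker d₁).subtype

/-- For `n ≥ 1` and a chain complex of `ℤ_n`-modules on finite cell sets with `d₁ ∘ d₂ = 0`,
the code space (functions supported on cycles and constant on homology classes) is
`ℂ`-linearly isomorphic to the space of all `ℂ`-valued functions on the homology module
`H = ker d₁ ⧸ B`; in particular its dimension is `|H|`, so the code space of the `ℤ_n`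
toric code is isomorphic to `ℂ[H_k(T, ℤ_n)]`. -/
theorem codeSpace_iso_functions_on_homology (n : ℕ) (hn : 1 ≤ n)
    (T₂ T₁ T₀ : Type) [Fintype T₂] [Fintype T₁] [Fintype T₀]
    (d₂ : (T₂ → ZMod n) →ₗ[ZMod n] (T₁ → ZMod n))
    (d₁ : (T₁ → ZMod n) →ₗ[ZMod n] (T₀ → ZMod n))
    (hdd : d₁ ∘ₗ d₂ = 0) :
    Nonempty ((codeSpace d₂ d₁) ≃ₗ[ℂ]
      ((LinearMap.ker d₁ ⧸ boundariesIn d₂ d₁) → ℂ)) := by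
  classical
  have hd : ∀ y, d₁ (d₂ y) = 0 := fun y => LinearMap.congr_fun hdd y
  -- pull a function on homology back to cycles and extend it by zero
  let L : ((LinearMap.ker d₁ ⧸ boundariesIn d₂ d₁) → ℂ) →ₗ[ℂ] ((T₁ → ZMod n) → ℂ) :=
    { toFun := fun g x =>
        if h : d₁ x = 0 then
          g (Submodule.Quotient.mk (⟨x, LinearMap.mem_ker.2 h⟩ : LinearMap.ker d₁))
        else 0
      map_add' := by
        intro f g
        funext x
        by_cases h : d₁ x = 0 <;> simp [h]
      map_smul' := by
        intro c g
        funext x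
        by_cases h : d₁ x = 0 <;> simp [h] }
  have hL : ∀ g x (h : d₁ x = 0), L g x =
      g (Submodule.Quotient.mk (⟨x, LinearMap.mem_ker.2 h⟩ : LinearMap.ker d₁)) :=
    fun g x h => dif_pos h
  have hL0 : ∀ g x, d₁ x ≠ 0 → L g x = 0 := fun g x h => dif_neg h
  have hmem : ∀ g, L g ∈ codeSpace d₂ d₁ := by
    intro g
    refine ⟨hL0 g, fun x y => ?_⟩
    by_cases h : d₁ x = 0
    · have h' : d₁ (x + d₂ y) = 0 := by rw [map_add, h, hd, add_zero]
      rw [hL g x h, hL g _ h']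
      congr 1
      rw [Submodule.Quotient.eq]
      exact ⟨y, by simp⟩
    · have h' : d₁ (x + d₂ y) ≠ 0 := by rwa [map_add, hd, add_zero]
      rw [hL0 g x h, hL0 g _ h']
  refine ⟨(LinearEquiv.ofBijective (L.codRestrict _ hmem) ⟨?_, ?_⟩).symm⟩
  · intro g g' hgg
    have e : L g = L g' := congrArg Subtype.val hgg
    funext q
    obtain ⟨⟨x, hx⟩, rfl⟩ := Submodule.Quotient.mk_surjective _ q
    have := congrFun e x
    rwa [hL g x hx, hL g' x hx] at this
  · rintro ⟨f, hf1, hf2⟩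
    refine ⟨fun q => f (Function.surjInv (Submodule.Quotient.mk_surjective _) q).1, ?_⟩
    apply Subtype.ext
    funext x
    change L _ x = f x
    by_cases h : d₁ x = 0
    · rw [hL _ x h]
      have e := Function.surjInv_eq (Submodule.Quotient.mk_surjective (boundariesIn d₂ d₁))
        (Submodule.Quotient.mk (⟨x, LinearMap.mem_ker.2 h⟩ : LinearMap.ker d₁))
      rw [Submodule.Quotient.eq] at e
      obtain ⟨y, hy⟩ := e
      have := hf2 x y
      rw [hy] at this
      simpa using this
    · rw [hL0 _ x h, hf1 x h]
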